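/- Let n ≥ 2 and let S be a symmetric future tensor (bilinear form) on ℝⁿ whose associated endomorphism is involutory, S♯ ∘ S♯ = id (a Lorentz tensor), and suppose there exists at least one k ∈ ∂Θ⁺ with S(k,k) = 0. Then P := ½(id + S♯) is an η-orthogonal projector: P ∘ P = P, η(P u, v) = η(u, P v) for all u,v, and the range of P equals the linear span of μ(S) = {k ∈ ∂Θ⁺ : S(k,k) = 0}. -/

import Mathlib

open Finset

/-- The Minkowski (Lorentzian) bilinear form on `Fin n → ℝ`:
`η(u,v) = u 0 * v 0 - ∑_{i ≠ 0} u i * v i`. -/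
def eta {n : ℕ} [NeZero n] (u v : Fin n → ℝ) : ℝ :=
  u 0 * v 0 - ∑ i ∈ Finset.univ.filter (fun i => i ≠ 0), u i * v i

/-- A future-directed causal vector: nonzero, `η(u,u) ≥ 0`, `u 0 > 0`.  (The set Θ⁺.) -/
def FutureCausal {n : ℕ} [NeZero n] (u : Fin n → ℝ) : Prop :=
  u ≠ 0 ∧ 0 ≤ eta u u ∧ 0 < u 0

/-- A future-directed null vector: nonzero, `η(u,u) = 0`, `u 0 > 0`.  (The set ∂Θ⁺.) -/
def FutureNull {n : ℕ} [NeZero n] (u : Fin n → ℝ) : Prop :=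
  u ≠ 0 ∧ eta u u = 0 ∧ 0 < u 0

/-- A null vector: nonzero with `η(u,u) = 0`. -/
def IsNull {n : ℕ} [NeZero n] (u : Fin n → ℝ) : Prop :=
  u ≠ 0 ∧ eta u u = 0

theorem eta_comm' {n : ℕ} [NeZero n] (u v : Fin n → ℝ) : eta u v = eta v u := by
  simp only [eta, mul_comm]

theorem eta_add_left' {n : ℕ} [NeZero n] (u v w : Fin n → ℝ) :
    eta (u + v) w = eta u w + eta v w := by
  simp only [eta, Pi.add_apply, add_mul, Finset.sum_add_distrib]; ring

theorem eta_smul_left' {n : ℕ} [NeZero n] (c : ℝ) (u w : Fin n → ℝ) :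
    eta (c • u) w = c * eta u w := by
  simp only [eta, Pi.smul_apply, smul_eq_mul, mul_assoc, ← Finset.mul_sum]; ring

theorem eta_add_right' {n : ℕ} [NeZero n] (u v w : Fin n → ℝ) :
    eta w (u + v) = eta w u + eta w v := by
  rw [eta_comm', eta_add_left', eta_comm' u, eta_comm' v]

theorem eta_smul_right' {n : ℕ} [NeZero n] (c : ℝ) (u w : Fin n → ℝ) :
    eta w (c • u) = c * eta w u := by
  rw [eta_comm', eta_smul_left', eta_comm' u]

theorem eta_single' {n : ℕ} [NeZero n] (u : Fin n → ℝ) : eta u (Pi.single 0 1) = u 0 := by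
  have : ∑ i ∈ Finset.univ.filter (fun i : Fin n => i ≠ 0), u i * (Pi.single 0 1 : Fin n → ℝ) i
      = 0 := by
    apply Finset.sum_eq_zero
    intro i hi
    simp only [Finset.mem_filter] at hi
    simp [hi.2]
  simp only [eta] at *
  rw [this]; simp

theorem eta_zero_of' {n : ℕ} [NeZero n] (x : Fin n → ℝ) (h0 : x 0 = 0) (h : eta x x = 0) :
    x = 0 := by
  have hs : ∑ i ∈ Finset.univ.filter (fun i : Fin n => i ≠ 0), x i * x i = 0 := by
    simp only [eta, h0] at h; linarith
  rw [Finset.sum_eq_zero_iff_of_nonneg (fun i _ => mul_self_nonneg _)] at hs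
  funext i
  by_cases hi : i = 0
  · rw [hi, h0]; rfl
  · exact mul_self_eq_zero.mp (hs i (by simp [hi]))

/-- For a Lorentz tensor `S` (symmetric future tensor with involutory associated
endomorphism) possessing a principal null direction, `P = ½(id + S♯)` is an
η-orthogonal projector onto the span of the principal directions of `S`. -/
theorem stmt_12 {n : ℕ} [NeZero n] (hn : 2 ≤ n)
    (S : (Fin n → ℝ) →ₗ[ℝ] (Fin n → ℝ) →ₗ[ℝ] ℝ)
    (hsym : ∀ u v, S u v = S v u)
    (hfut : ∀ u v, FutureCausal u → FutureCausal v → 0 ≤ S u v)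
    (Ssharp : (Fin n → ℝ) →ₗ[ℝ] (Fin n → ℝ))
    (hSsharp : ∀ u v, eta (Ssharp u) v = S u v)
    (hinv : Ssharp ∘ₗ Ssharp = LinearMap.id)
    (hmu : ∃ k, FutureNull k ∧ S k k = 0) :
    ∀ P : (Fin n → ℝ) →ₗ[ℝ] (Fin n → ℝ),
      P = (2⁻¹ : ℝ) • (LinearMap.id + Ssharp) →
      (P ∘ₗ P = P) ∧ (∀ u v, eta (P u) v = eta u (P v)) ∧
      LinearMap.range P = Submodule.span ℝ {k | FutureNull k ∧ S k k = 0} := by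
  intro P hP
  have hTT : ∀ u, Ssharp (Ssharp u) = u := fun u => by
    simpa using LinearMap.congr_fun hinv u
  have hTs : ∀ u v, eta (Ssharp u) v = eta u (Ssharp v) := fun u v => by
    rw [hSsharp, hsym, ← hSsharp, eta_comm']
  have hPa : ∀ u, P u = (2⁻¹ : ℝ) • (u + Ssharp u) := fun u => by rw [hP]; rfl
  have hPs : ∀ u v, eta (P u) v = eta u (P v) := fun u v => by
    simp only [hPa, eta_smul_left', eta_smul_right', eta_add_left', eta_add_right', hTs]
  have hTP : ∀ u, Ssharp (P u) = P u := fun u => by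
    rw [hPa, map_smul, map_add, hTT, add_comm]
  have hfix : ∀ u, Ssharp u = u → P u = u := fun u h => by
    rw [hPa, h, ← two_smul ℝ u, smul_smul]; norm_num
  have hPP : ∀ u, P (P u) = P u := fun u => hfix _ (hTP u)
  have he0 : FutureCausal (Pi.single 0 1 : Fin n → ℝ) := by
    refine ⟨by simp, ?_, by simp⟩
    rw [eta_single']; simp
  have key : ∀ k, FutureNull k → S k k = 0 → Ssharp k = k := by
    intro k hk hS
    obtain ⟨hk0, hkk, hkp⟩ := hk
    have h1 : eta (Ssharp k) (Ssharp k) = 0 := by rw [hTs, hTT, hkk]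
    have h2 : eta (Ssharp k) k = 0 := by rw [hSsharp, hS]
    have h3 : 0 ≤ Ssharp k 0 := by
      rw [← eta_single' (Ssharp k), hSsharp]
      exact hfut _ _ ⟨hk0, hkk.ge, hkp⟩ he0
    have h4 : k 0 • Ssharp k + (-(Ssharp k 0)) • k = 0 := by
      apply eta_zero_of'
      · simp only [Pi.add_apply, Pi.smul_apply, smul_eq_mul]; ring
      · simp only [eta_smul_left', eta_smul_right', eta_add_left', eta_add_right', h1, h2, hkk,
          eta_comm' k (Ssharp k)]
        ring
    have h5 := congrArg Ssharp h4
    rw [map_add, map_smul, map_smul, hTT, map_zero] at h5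
    have h6 := congrFun h5 0
    simp only [Pi.add_apply, Pi.smul_apply, smul_eq_mul, Pi.zero_apply] at h6
    have h7 : Ssharp k 0 = k 0 := by nlinarith
    rw [h7, neg_smul, ← sub_eq_add_neg, ← smul_sub] at h4
    exact sub_eq_zero.mp ((smul_eq_zero.mp h4).resolve_left hkp.ne')
  refine ⟨LinearMap.ext hPP, hPs, le_antisymm ?_ ?_⟩
  · obtain ⟨k, hk, hkS⟩ := hmu
    have hTk := key k hk hkS
    have hkm : k ∈ Submodule.span ℝ {k | FutureNull k ∧ S k k = 0} :=
      Submodule.subset_span ⟨hk, hkS⟩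
    -- null vectors fixed by the endomorphism lie in the span
    have hnull : ∀ l, Ssharp l = l → eta l l = 0 →
        l ∈ Submodule.span ℝ {k | FutureNull k ∧ S k k = 0} := by
      intro l hl hll
      have hSl : S l l = 0 := by rw [← hSsharp, hl, hll]
      rcases lt_trichotomy (l 0) 0 with h | h | h
      · rw [← neg_neg l]
        refine Submodule.neg_mem _ (Submodule.subset_span ⟨⟨?_, ?_, ?_⟩, ?_⟩)
        · intro h0; rw [neg_eq_zero.mp h0] at h; simp at h
        · rw [← neg_one_smul ℝ l, eta_smul_left', eta_smul_right', hll]; simp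
        · simpa using h
        · simp [hSl]
      · rw [eta_zero_of' l h hll]; exact Submodule.zero_mem _
      · refine Submodule.subset_span ⟨⟨?_, hll, h⟩, hSl⟩
        intro h0; rw [h0] at h; simp at h
    have hgen : ∀ w, Ssharp w = w → eta k w ≠ 0 →
        w ∈ Submodule.span ℝ {k | FutureNull k ∧ S k k = 0} := by
      intro w hw hkw
      have : w + (-(eta w w / (2 * eta k w))) • k ∈
          Submodule.span ℝ {k | FutureNull k ∧ S k k = 0} := by
        apply hnull
        · rw [map_add, map_smul, hw, hTk]
        · simp only [eta_smul_left', eta_smul_right', eta_add_left', eta_add_right', hk.2.1,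
            eta_comm' w k]
          field_simp
          ring
      exact (Submodule.add_mem_iff_left _ (Submodule.smul_mem _ _ hkm)).mp this
    rintro _ ⟨u, rfl⟩
    have hv : eta k (P (Pi.single 0 1)) ≠ 0 := by
      rw [← hPs, hfix k hTk, eta_single']; exact hk.2.2.ne'
    by_cases h : eta k (P u) = 0
    · have hvm := hgen _ (hTP _) hv
      have := hgen (P u + P (Pi.single 0 1)) (by rw [map_add, hTP, hTP])
        (by rw [eta_add_right', h, zero_add]; exact hv)
      exact (Submodule.add_mem_iff_left _ hvm).mp this
    · exact hgen _ (hTP u) h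
  · rw [Submodule.span_le]
    rintro k ⟨hk, hkS⟩
    exact ⟨k, hfix k (key k hk hkS)⟩
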